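/- arXiv:2505.02981 — 2 statements merged into one kernel-verified Lean document; each statement's English description precedes it below -/
import Mathlib

section
/- Let γ be convex and nondecreasing on I = [a,b] (with finite one-sided derivatives at the endpoints) with W(Γ,I) ≤ 1, let r > 0, and let [s,u] ⊆ [a,b] with s < u. Assume that either (i) u < b and W(Γ,[s,u+η]) > r for every η ∈ (0, b−u], or (ii) s > a and W(Γ,[s−η,u]) > r for every η ∈ (0, s−a]. Then r·L(Γ,[a,b]) ≤ L(Γ,[s,u]) ≤ L(Γ,[a,b]). -/
open Set

/-- `segA γR γL a b` is `A(Γ,[a,b]) = (γ'_L(b) − γ'_R(a))/(1 + γ'_L(b)·γ'_R(a))`. -/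
noncomputable def segA (γR γL : ℝ → ℝ) (a b : ℝ) : ℝ :=
  (γL b - γR a) / (1 + γL b * γR a)

/-- `segL γ a b` is `L(Γ,[a,b]) = ‖Γ(b) − Γ(a)‖` with `Γ(t) = (t, γ t)` (Euclidean norm). -/
noncomputable def segL (γ : ℝ → ℝ) (a b : ℝ) : ℝ :=
  Real.sqrt ((b - a) ^ 2 + (γ b - γ a) ^ 2)

/-- `segW γ γR γL a b` is `W(Γ,[a,b]) = L(Γ,[a,b])·A(Γ,[a,b])`. -/
noncomputable def segW (γ γR γL : ℝ → ℝ) (a b : ℝ) : ℝ :=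
  segL γ a b * segA γR γL a b

/-- `γR` and `γL` are the one-sided derivatives of `γ` on the interval `[a,b]`:
the right derivative is defined on `[a,b)` and the left derivative on `(a,b]`. -/
def HasOneSidedDerivs (γ γR γL : ℝ → ℝ) (a b : ℝ) : Prop :=
  (∀ x ∈ Set.Ico a b, HasDerivWithinAt γ (γR x) (Set.Ioc x b) x) ∧
  (∀ x ∈ Set.Ioc a b, HasDerivWithinAt γ (γL x) (Set.Ico a x) x)

open Filter Topology

namespace HasOneSidedDerivs

variable {γ γR γL : ℝ → ℝ} {a b x y : ℝ}

lemma hasDerivWithinAt_Ioi (h : HasOneSidedDerivs γ γR γL a b) (hx : x ∈ Ico a b) :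
    HasDerivWithinAt γ (γR x) (Ioi x) x :=
  (h.1 x hx).mono_of_mem_nhdsWithin (Ioc_mem_nhdsGT hx.2)

lemma hasDerivWithinAt_Iio (h : HasOneSidedDerivs γ γR γL a b) (hx : x ∈ Ioc a b) :
    HasDerivWithinAt γ (γL x) (Iio x) x :=
  (h.2 x hx).mono_of_mem_nhdsWithin (Ico_mem_nhdsLT hx.1)

lemma left_le_right (h : HasOneSidedDerivs γ γR γL a b) (hconv : ConvexOn ℝ (Icc a b) γ)
    (hx : x ∈ Ioo a b) : γL x ≤ γR x := by
  rw [← (h.hasDerivWithinAt_Ioi (Ioo_subset_Ico_self hx)).derivWithin (uniqueDiffWithinAt_Ioi x),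
    ← (h.hasDerivWithinAt_Iio (Ioo_subset_Ioc_self hx)).derivWithin (uniqueDiffWithinAt_Iio x)]
  exact hconv.leftDeriv_le_rightDeriv_of_mem_interior (by rwa [interior_Icc])

lemma right_le_left (h : HasOneSidedDerivs γ γR γL a b) (hconv : ConvexOn ℝ (Icc a b) γ)
    (hx : a ≤ x) (hxy : x < y) (hy : y ≤ b) : γR x ≤ γL y := by
  have hxI : x ∈ Icc a b := ⟨hx, hxy.le.trans hy⟩
  have hyI : y ∈ Icc a b := ⟨hx.trans hxy.le, hy⟩
  exact (hconv.le_slope_of_hasDerivWithinAt_Ioi hxI hyI hxy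
      (h.hasDerivWithinAt_Ioi ⟨hx, hxy.trans_le hy⟩)).trans
    (hconv.slope_le_of_hasDerivWithinAt_Iio hxI hyI hxy
      (h.hasDerivWithinAt_Iio ⟨hx.trans_lt hxy, hy⟩))

lemma right_mono (h : HasOneSidedDerivs γ γR γL a b) (hconv : ConvexOn ℝ (Icc a b) γ)
    (hx : a ≤ x) (hxy : x ≤ y) (hy : y < b) : γR x ≤ γR y := by
  rcases hxy.eq_or_lt with rfl | hlt
  · rfl
  · exact (h.right_le_left hconv hx hlt hy.le).trans
      (h.left_le_right hconv ⟨hx.trans_lt hlt, hy⟩)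

lemma left_mono (h : HasOneSidedDerivs γ γR γL a b) (hconv : ConvexOn ℝ (Icc a b) γ)
    (hx : a < x) (hxy : x ≤ y) (hy : y ≤ b) : γL x ≤ γL y := by
  rcases hxy.eq_or_lt with rfl | hlt
  · rfl
  · exact (h.left_le_right hconv ⟨hx, hlt.trans_le hy⟩).trans
      (h.right_le_left hconv hx.le hlt hy)

lemma right_nonneg (h : HasOneSidedDerivs γ γR γL a b) (hmono : MonotoneOn γ (Icc a b))
    (hab : a < b) : 0 ≤ γR a := by
  have hd : HasDerivWithinAt γ (γR a) (Icc a b) a :=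
    (h.hasDerivWithinAt_Ioi ⟨le_rfl, hab⟩).Ici_of_Ioi.mono Icc_subset_Ici_self
  rw [← hd.derivWithin (uniqueDiffOn_Icc hab a ⟨le_rfl, hab.le⟩)]
  exact hmono.derivWithin_nonneg

/-- The turning quantity `segA` is monotone under inclusion of intervals. -/
lemma segA_le (h : HasOneSidedDerivs γ γR γL a b) (hconv : ConvexOn ℝ (Icc a b) γ)
    (hmono : MonotoneOn γ (Icc a b)) (hx : a ≤ x) (hxy : x < y) (hy : y ≤ b) :
    segA γR γL x y ≤ segA γR γL a b := by
  have hp := h.right_nonneg hmono (hx.trans_lt (hxy.trans_le hy))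
  have hpx := h.right_mono hconv le_rfl hx (hxy.trans_le hy)
  have hxy' := h.right_le_left hconv hx hxy hy
  have hyb := h.left_mono hconv (hx.trans_lt hxy) hy le_rfl
  have hpos : 0 ≤ γL y := by linarith
  unfold segA
  calc (γL y - γR x) / (1 + γL y * γR x)
      ≤ (γL y - γR a) / (1 + γL y * γR a) := by
        rw [div_le_div_iff₀ (by nlinarith) (by positivity)]
        nlinarith [mul_nonneg (sub_nonneg.2 hpx) (by positivity : 0 ≤ 1 + γL y ^ 2)]
    _ ≤ (γL b - γR a) / (1 + γL b * γR a) := by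
        rw [div_le_div_iff₀ (by positivity) (by nlinarith)]
        nlinarith [mul_nonneg (sub_nonneg.2 hyb) (by positivity : 0 ≤ 1 + γR a ^ 2)]

end HasOneSidedDerivs

lemma MonotoneOn.segL_le {γ : ℝ → ℝ} {a b s u : ℝ} (hmono : MonotoneOn γ (Icc a b))
    (has : a ≤ s) (hsu : s ≤ u) (hub : u ≤ b) : segL γ s u ≤ segL γ a b := by
  have h₁ := hmono ⟨le_rfl, by linarith⟩ ⟨has, by linarith⟩ has
  have h₂ := hmono ⟨has, by linarith⟩ ⟨by linarith, hub⟩ hsu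
  have h₃ := hmono ⟨by linarith, hub⟩ ⟨by linarith, le_rfl⟩ hub
  unfold segL
  gcongr

theorem statement_6 (a b s u r : ℝ) (γ γR γL : ℝ → ℝ)
    (hconv : ConvexOn ℝ (Icc a b) γ) (hmono : MonotoneOn γ (Icc a b))
    (hderiv : HasOneSidedDerivs γ γR γL a b)
    (hWI : segW γ γR γL a b ≤ 1) (hr : 0 < r)
    (has : a ≤ s) (hsu : s < u) (hub : u ≤ b)
    (hcase :
      (u < b ∧ ∀ η : ℝ, 0 < η → η ≤ b - u → r < segW γ γR γL s (u + η)) ∨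
      (a < s ∧ ∀ η : ℝ, 0 < η → η ≤ s - a → r < segW γ γR γL (s - η) u)) :
    r * segL γ a b ≤ segL γ s u ∧ segL γ s u ≤ segL γ a b := by
  have hA := fun {x y : ℝ} (hx : a ≤ x) (hxy : x < y) (hy : y ≤ b) =>
    hderiv.segA_le hconv hmono hx hxy hy
  have hL0 : ∀ x y, 0 ≤ segL γ x y := fun x y => Real.sqrt_nonneg _
  have key : r ≤ segL γ s u * segA γR γL a b := by
    rcases hcase with ⟨hu, hW⟩ | ⟨hs, hW⟩
    · have hc : Tendsto γ (𝓝[>] u) (𝓝 (γ u)) :=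
        (hderiv.hasDerivWithinAt_Ioi ⟨has.trans hsu.le, hu⟩).continuousWithinAt
      have ht : Tendsto (fun v => segL γ s v * segA γR γL a b) (𝓝[>] u)
          (𝓝 (segL γ s u * segA γR γL a b)) :=
        ((((tendsto_id.mono_left nhdsWithin_le_nhds).sub_const s).pow 2).add
          ((hc.sub_const (γ s)).pow 2)).sqrt.mul_const _
      refine ge_of_tendsto ht ?_
      filter_upwards [Ioc_mem_nhdsGT hu] with v hv
      have hr' := hW (v - u) (sub_pos.2 hv.1) (by linarith [hv.2])
      rw [add_sub_cancel] at hr'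
      exact hr'.le.trans
        (mul_le_mul_of_nonneg_left (hA has (hsu.trans hv.1) hv.2) (hL0 _ _))
    · have hc : Tendsto γ (𝓝[<] s) (𝓝 (γ s)) :=
        (hderiv.hasDerivWithinAt_Iio ⟨hs, hsu.le.trans hub⟩).continuousWithinAt
      have ht : Tendsto (fun v => segL γ v u * segA γR γL a b) (𝓝[<] s)
          (𝓝 (segL γ s u * segA γR γL a b)) :=
        ((((tendsto_id.mono_left nhdsWithin_le_nhds).const_sub u).pow 2).add
          ((hc.const_sub (γ u)).pow 2)).sqrt.mul_const _
      refine ge_of_tendsto ht ?_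
      filter_upwards [Ico_mem_nhdsLT hs] with v hv
      have hr' := hW (s - v) (sub_pos.2 hv.2) (by linarith [hv.1])
      rw [sub_sub_cancel] at hr'
      exact hr'.le.trans
        (mul_le_mul_of_nonneg_left (hA hv.1 (hv.2.trans hsu) hub) (hL0 _ _))
  refine ⟨?_, hmono.segL_le has hsu.le hub⟩
  calc r * segL γ a b ≤ segL γ s u * segA γR γL a b * segL γ a b :=
        mul_le_mul_of_nonneg_right key (hL0 _ _)
    _ = segL γ s u * segW γ γR γL a b := by unfold segW; ring
    _ ≤ segL γ s u := mul_le_of_le_one_right (hL0 _ _) hWI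
end

section
/- Let R ≥ 1, ε ∈ (0,1/2), let (γ,[a,b]) be admissible with parameters R, ε, and let k ≥ 1 be an integer. Let [t,v] ⊆ [a,b] with t < v satisfy L(Γ,[t,v]) ≥ R^{−(k−2)ε} and W(Γ,[t,v]) ≤ R^{−kε}. Define the similarity 𝓛(ξ) := (R^{kε}/(1+γ'_R(t)²)^{1/2})·M·(ξ − Γ(t)), where M is the 2×2 matrix with rows (1, γ'_R(t)) and (−γ'_R(t), 1). Then there exist b̃ > 0 and a convex function γ̃ : [0,b̃] → ℝ such that 𝓛({(x,γ(x)) : x ∈ [t,v]}) = {(x, γ̃(x)) : x ∈ [0,b̃]} and the pair (γ̃,[0,b̃]) is admissible with parameters R, ε. -/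
open Set

/-- The pair `(γ,[a,b])` is admissible with parameters `R, ε`:
γ is convex on `[a,b]` with one-sided derivatives `γR, γL`, and
(C1) `A(Γ,[a,b]) ≤ R^{−2ε}`; (C2) `L(Γ,[a,b]) ≥ R^{2ε}`;
(C3) `γ(a) = 0` and `γ'_R(a) = 0`; (C4) `W(Γ,[a,b]) ≤ 1`. -/
noncomputable def AdmissiblePair (R ε : ℝ) (γ γR γL : ℝ → ℝ) (a b : ℝ) : Prop :=
  a < b ∧ ConvexOn ℝ (Set.Icc a b) γ ∧ HasOneSidedDerivs γ γR γL a b ∧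
  segA γR γL a b ≤ R ^ (-(2 * ε)) ∧
  R ^ (2 * ε) ≤ segL γ a b ∧
  γ a = 0 ∧ γR a = 0 ∧
  segW γ γR γL a b ≤ 1

open Filter Topology

/-- The derivative of a graph given parametrically by `(X, Y)`, where `g` is a right inverse
of `X` near the base point. -/
lemma HasDerivWithinAt.of_parametrization {X Y g h : ℝ → ℝ} {S T : Set ℝ} {u x dX dY : ℝ}
    (hX : HasDerivWithinAt X dX S x) (hY : HasDerivWithinAt Y dY S x) (hdX : dX ≠ 0)
    (hxS : x ∉ S) (huT : u ∉ T) (hXx : X x = u) (hhu : h u = Y x)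
    (hgS : MapsTo g T S) (hXg : ∀ w ∈ T, X (g w) = w) (hh : ∀ w ∈ T, h w = Y (g w))
    (hg : Tendsto g (𝓝[T] u) (𝓝 x)) :
    HasDerivWithinAt h (dY / dX) T u := by
  rw [hasDerivWithinAt_iff_tendsto_slope' hxS] at hX hY
  rw [hasDerivWithinAt_iff_tendsto_slope' huT]
  have hgS' : Tendsto g (𝓝[T] u) (𝓝[S] x) :=
    tendsto_nhdsWithin_iff.2 ⟨hg, eventually_mem_nhdsWithin.mono hgS⟩
  refine ((hY.div hX hdX).comp hgS').congr' ?_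
  filter_upwards [self_mem_nhdsWithin] with w hw
  have hne : g w - x ≠ 0 := sub_ne_zero.2 fun h0 => hxS (h0 ▸ hgS hw)
  simp only [Function.comp_apply, Pi.div_apply, slope_def_field, hXg w hw, hXx, hh w hw, hhu]
  rw [div_div_div_cancel_right₀ hne]

lemma ConvexOn.monotoneOn_of_rightDeriv_nonneg {f : ℝ → ℝ} {a b d : ℝ}
    (hf : ConvexOn ℝ (Icc a b) f) (hd : HasDerivWithinAt f d (Ioc a b) a) (hd0 : 0 ≤ d) :
    MonotoneOn f (Icc a b) := by
  intro x hx y hy hxy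
  rcases hxy.eq_or_lt with rfl | hxy
  · rfl
  have hay : a < y := hx.1.trans_lt hxy
  have ha : a ∈ Icc a b := ⟨le_rfl, hx.1.trans hx.2⟩
  have hab : a < b := hay.trans_le hy.2
  have hd' : HasDerivWithinAt f d (Ioi a) a :=
    hd.mono_of_mem_nhdsWithin (Ioc_mem_nhdsGT hab)
  rcases hx.1.eq_or_lt with rfl | hax
  · have h := hd0.trans (hf.le_slope_of_hasDerivWithinAt_Ioi ha hy hxy hd')
    rw [slope_def_field, le_div_iff₀ (sub_pos.2 hxy)] at h
    linarith
  · have h := hd0.trans (hf.le_slope_of_hasDerivWithinAt_Ioi ha hx hax hd')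
    rw [slope_def_field] at h
    have h2 := h.trans (hf.slope_mono_adjacent ha hy hax hxy)
    rw [le_div_iff₀ (sub_pos.2 hxy)] at h2
    linarith

lemma HasOneSidedDerivs.mono {γ γR γL : ℝ → ℝ} {a b t v : ℝ}
    (h : HasOneSidedDerivs γ γR γL a b) (hat : a ≤ t) (hvb : v ≤ b) :
    HasOneSidedDerivs γ γR γL t v :=
  ⟨fun x hx => (h.1 x ⟨hat.trans hx.1, hx.2.trans_le hvb⟩).mono (Ioc_subset_Ioc_right hvb),
    fun x hx => (h.2 x ⟨hat.trans_lt hx.1, hx.2.trans hvb⟩).mono (Ico_subset_Ico_left hat)⟩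

lemma HasOneSidedDerivs.continuousOn {γ γR γL : ℝ → ℝ} {a b : ℝ}
    (h : HasOneSidedDerivs γ γR γL a b) : ContinuousOn γ (Icc a b) := by
  intro x hx
  have hl : ContinuousWithinAt γ (Ico a x) x := by
    rcases hx.1.eq_or_lt with rfl | hax
    · simp [ContinuousWithinAt]
    · exact (h.2 x ⟨hax, hx.2⟩).continuousWithinAt
  have hr : ContinuousWithinAt γ (Ioc x b) x := by
    rcases hx.2.eq_or_lt with rfl | hxb
    · simp [ContinuousWithinAt]
    · exact (h.1 x ⟨hx.1, hxb⟩).continuousWithinAt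
  refine ((hl.union hr).insert).mono fun y hy => ?_
  rcases lt_trichotomy y x with hyx | rfl | hxy
  · exact Or.inr (Or.inl ⟨hy.1, hyx⟩)
  · exact Or.inl rfl
  · exact Or.inr (Or.inr ⟨hxy, hy.2⟩)

lemma HasOneSidedDerivs.rightDeriv_nonneg {γ γR γL : ℝ → ℝ} {a b x : ℝ}
    (h : HasOneSidedDerivs γ γR γL a b) (hm : MonotoneOn γ (Icc a b)) (hx : x ∈ Ico a b) :
    0 ≤ γR x := by
  have hd := (hasDerivWithinAt_iff_tendsto_slope' left_notMem_Ioc).1 (h.1 x hx)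
  have : (𝓝[Ioc x b] x).NeBot := by
    rw [nhdsWithin_Ioc_eq_nhdsGT hx.2]; infer_instance
  refine ge_of_tendsto hd ?_
  filter_upwards [self_mem_nhdsWithin] with y hy
  rw [slope_def_field]
  exact div_nonneg (sub_nonneg.2 (hm ⟨hx.1, hx.2.le⟩ ⟨hx.1.trans hy.1.le, hy.2⟩ hy.1.le))
    (sub_nonneg.2 hy.1.le)

lemma HasOneSidedDerivs.leftDeriv_nonneg {γ γR γL : ℝ → ℝ} {a b x : ℝ}
    (h : HasOneSidedDerivs γ γR γL a b) (hm : MonotoneOn γ (Icc a b)) (hx : x ∈ Ioc a b) :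
    0 ≤ γL x := by
  have hd := (hasDerivWithinAt_iff_tendsto_slope' right_notMem_Ico).1 (h.2 x hx)
  have : (𝓝[Ico a x] x).NeBot := by
    rw [nhdsWithin_Ico_eq_nhdsLT hx.1]; infer_instance
  refine ge_of_tendsto hd ?_
  filter_upwards [self_mem_nhdsWithin] with y hy
  rw [slope_def_field]
  exact div_nonneg_of_nonpos
    (sub_nonpos.2 (hm ⟨hy.1, hy.2.le.trans hx.2⟩ ⟨hx.1.le, hx.2⟩ hy.2.le))
    (sub_nonpos.2 hy.2.le)

/-- Rotating clockwise by the angle of slope `m ≥ 0` (and scaling by `p * √(1 + m ^ 2)`) maps the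
graph of a nondecreasing convex function to the graph of a convex function, whose one-sided
slopes are given by the subtraction formula for the tangent. -/
lemma exists_convexOn_graph_of_rotation {γ γR γL : ℝ → ℝ} {t v m p : ℝ} (htv : t < v)
    (hm : 0 ≤ m) (hp : 0 < p) (hγ : ConvexOn ℝ (Icc t v) γ) (hmono : MonotoneOn γ (Icc t v))
    (hd : HasOneSidedDerivs γ γR γL t v) :
    ∃ (b' : ℝ) (γ' γ'R γ'L : ℝ → ℝ), 0 < b' ∧
      (fun ξ : ℝ × ℝ => (p * ((ξ.1 - t) + m * (ξ.2 - γ t)),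
          p * (-m * (ξ.1 - t) + (ξ.2 - γ t)))) '' {q : ℝ × ℝ | ∃ x ∈ Icc t v, q = (x, γ x)} =
        {q : ℝ × ℝ | ∃ x ∈ Icc 0 b', q = (x, γ' x)} ∧
      ConvexOn ℝ (Icc 0 b') γ' ∧ HasOneSidedDerivs γ' γ'R γ'L 0 b' ∧
      b' = p * ((v - t) + m * (γ v - γ t)) ∧
      γ' 0 = 0 ∧ γ' b' = p * (-m * (v - t) + (γ v - γ t)) ∧
      γ'R 0 = (γR t - m) / (1 + m * γR t) ∧ γ'L b' = (γL v - m) / (1 + m * γL v) := by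
  set X : ℝ → ℝ := fun x => p * ((x - t) + m * (γ x - γ t)) with hX
  set Y : ℝ → ℝ := fun x => p * (-m * (x - t) + (γ x - γ t)) with hY
  have ht : t ∈ Icc t v := ⟨le_rfl, htv.le⟩
  have hv : v ∈ Icc t v := ⟨htv.le, le_rfl⟩
  have hexp : ∀ x ∈ Icc t v, ∀ y ∈ Icc t v, x ≤ y → p * (y - x) ≤ X y - X x := by
    intro x hx y hy hxy
    have h1 := mul_nonneg hp.le (mul_nonneg hm (sub_nonneg.2 (hmono hx hy hxy)))
    simp only [hX]
    linarith
  have hXmono : StrictMonoOn X (Icc t v) := by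
    intro x hx y hy hxy
    have := hexp x hx y hy hxy.le
    have := mul_pos hp (sub_pos.2 hxy)
    linarith
  have hXt : X t = 0 := by simp [hX]
  have hYt : Y t = 0 := by simp [hY]
  have hb' : 0 < X v := hXt ▸ hXmono ht hv htv
  have hXcont : ContinuousOn X (Icc t v) := by
    have := hd.continuousOn
    simp only [hX]
    fun_prop
  have hXimg : X '' Icc t v = Icc 0 (X v) := by
    refine Subset.antisymm ?_ ?_
    · rintro _ ⟨x, hx, rfl⟩
      exact ⟨hXt ▸ hXmono.monotoneOn ht hx hx.1, hXmono.monotoneOn hx hv hx.2⟩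
    · simpa [hXt] using intermediate_value_Icc htv.le hXcont
  set g : ℝ → ℝ := Function.invFunOn X (Icc t v) with hg
  have hgX : ∀ x ∈ Icc t v, g (X x) = x := fun x hx => hXmono.injOn.leftInvOn_invFunOn hx
  have hgmem : ∀ u ∈ Icc 0 (X v), g u ∈ Icc t v := fun u hu =>
    Function.invFunOn_mem (by rwa [← hXimg] at hu)
  have hXg : ∀ u ∈ Icc 0 (X v), X (g u) = u := fun u hu =>
    Function.invFunOn_eq (by rwa [← hXimg] at hu)
  have hgmono : ∀ u ∈ Icc 0 (X v), ∀ w ∈ Icc 0 (X v), u < w → g u < g w := by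
    intro u hu w hw huw
    rw [← hXmono.lt_iff_lt (hgmem u hu) (hgmem w hw), hXg u hu, hXg w hw]
    exact huw
  have hgcont : ContinuousOn g (Icc 0 (X v)) := by
    have hlip : LipschitzOnWith (Real.toNNReal p⁻¹) g (Icc 0 (X v)) := by
      refine LipschitzOnWith.of_le_add_mul _ fun u hu w hw => ?_
      rw [Real.coe_toNNReal _ (by positivity), Real.dist_eq]
      rcases le_total (g u) (g w) with h | h
      · have := mul_nonneg (inv_nonneg.2 hp.le) (abs_nonneg (u - w))
        linarith
      · have h1 := hexp _ (hgmem w hw) _ (hgmem u hu) h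
        rw [hXg u hu, hXg w hw] at h1
        have h2 := h1.trans (le_abs_self _)
        have h3 : g u - g w ≤ p⁻¹ * |u - w| := by
          rwa [inv_mul_eq_div, le_div_iff₀ hp, mul_comm]
        linarith
    exact hlip.continuousOn
  have hg0 : g 0 = t := by rw [← hXt, hgX t ht]
  have hgb : g (X v) = v := hgX v hv
  have hgr : ∀ u ∈ Ico 0 (X v), g u ∈ Ico t v := fun u hu =>
    ⟨(hgmem u ⟨hu.1, hu.2.le⟩).1,
      hgb ▸ hgmono u ⟨hu.1, hu.2.le⟩ (X v) ⟨hb'.le, le_rfl⟩ hu.2⟩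
  have hgl : ∀ u ∈ Ioc 0 (X v), g u ∈ Ioc t v := fun u hu =>
    ⟨hg0 ▸ hgmono 0 ⟨le_rfl, hb'.le⟩ u ⟨hu.1.le, hu.2⟩ hu.1, (hgmem u ⟨hu.1.le, hu.2⟩).2⟩
  have hderX : ∀ {d : ℝ} {S : Set ℝ} {x : ℝ}, HasDerivWithinAt γ d S x →
      HasDerivWithinAt X (p * (1 + m * d)) S x := fun h =>
    (((hasDerivWithinAt_id _ _).sub_const t).add ((h.sub_const (γ t)).const_mul m)).const_mul p
  have hderY : ∀ {d : ℝ} {S : Set ℝ} {x : ℝ}, HasDerivWithinAt γ d S x →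
      HasDerivWithinAt Y (p * (d - m)) S x := fun {d S x} h => by
    have := ((((hasDerivWithinAt_id x S).sub_const t).const_mul (-m)).add
      (h.sub_const (γ t))).const_mul p
    convert! this using 1
    ring
  refine ⟨X v, Y ∘ g, fun u => (γR (g u) - m) / (1 + m * γR (g u)),
    fun u => (γL (g u) - m) / (1 + m * γL (g u)), hb', ?_, ?_, ⟨?_, ?_⟩, rfl, ?_, ?_, ?_, ?_⟩
  · ext q
    constructor
    · rintro ⟨_, ⟨x, hx, rfl⟩, rfl⟩
      refine ⟨X x, hXimg ▸ mem_image_of_mem X hx, ?_⟩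
      rw [Function.comp_apply, hgX x hx]
    · rintro ⟨u, hu, rfl⟩
      refine ⟨(g u, γ (g u)), ⟨g u, hgmem u hu, rfl⟩, ?_⟩
      exact Prod.ext (hXg u hu) rfl
  · refine convexOn_of_slope_mono_adjacent (convex_Icc _ _) fun {x y z} hx hz hxy hyz => ?_
    have hy : y ∈ Icc 0 (X v) := ⟨hx.1.trans hxy.le, hyz.le.trans hz.2⟩
    have h1 := hgmono x hx y hy hxy
    have h2 := hgmono y hy z hz hyz
    have hs := hγ.slope_mono_adjacent (hgmem x hx) (hgmem z hz) h1 h2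
    rw [div_le_div_iff₀ (sub_pos.2 h1) (sub_pos.2 h2)] at hs
    rw [div_le_div_iff₀ (sub_pos.2 hxy) (sub_pos.2 hyz)]
    have hk : 0 ≤ p ^ 2 * (1 + m ^ 2) := by positivity
    have hs' := mul_le_mul_of_nonneg_left hs hk
    have ex := hXg x hx
    have ey := hXg y hy
    have ez := hXg z hz
    have key : (Y (g y) - Y (g x)) * (X (g z) - X (g y)) ≤
        (Y (g z) - Y (g y)) * (X (g y) - X (g x)) := by
      simp only [hX, hY]
      linarith
    rwa [ex, ey, ez] at key
  · intro u hu
    have hu' : u ∈ Icc 0 (X v) := ⟨hu.1, hu.2.le⟩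
    have hγu := hd.1 (g u) (hgr u hu)
    have hpos := hd.rightDeriv_nonneg hmono (hgr u hu)
    have hT : Ioc u (X v) ⊆ Icc 0 (X v) := fun w hw => ⟨hu.1.trans hw.1.le, hw.2⟩
    beta_reduce
    rw [← mul_div_mul_left _ _ hp.ne']
    exact (hderX hγu).of_parametrization (hderY hγu) (by positivity) left_notMem_Ioc
      left_notMem_Ioc (hXg u hu') rfl
      (fun w hw => ⟨hgmono u hu' w (hT hw) hw.1, (hgmem w (hT hw)).2⟩)
      (fun w hw => hXg w (hT hw)) (fun w _ => rfl) ((hgcont u hu').mono hT)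
  · intro u hu
    have hu' : u ∈ Icc 0 (X v) := ⟨hu.1.le, hu.2⟩
    have hγu := hd.2 (g u) (hgl u hu)
    have hpos := hd.leftDeriv_nonneg hmono (hgl u hu)
    have hT : Ico 0 u ⊆ Icc 0 (X v) := fun w hw => ⟨hw.1, hw.2.le.trans hu.2⟩
    beta_reduce
    rw [← mul_div_mul_left _ _ hp.ne']
    exact (hderX hγu).of_parametrization (hderY hγu) (by positivity) right_notMem_Ico
      right_notMem_Ico (hXg u hu') rfl
      (fun w hw => ⟨(hgmem w (hT hw)).1, hgmono w (hT hw) u hu' hw.2⟩)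
      (fun w hw => hXg w (hT hw)) (fun w _ => rfl) ((hgcont u hu').mono hT)
  · simp only [Function.comp_apply, hg0, hYt]
  · simp only [Function.comp_apply, hgb, hY]
  · simp only [hg0]
  · simp only [hgb]

theorem statement_10 (R ε a b t v : ℝ) (γ γR γL : ℝ → ℝ) (k : ℕ)
    (hR : 1 ≤ R) (hε : ε ∈ Ioo (0:ℝ) (1/2)) (hk : 1 ≤ k)
    (hadm : AdmissiblePair R ε γ γR γL a b)
    (hat : a ≤ t) (htv : t < v) (hvb : v ≤ b)
    (hlen : R ^ (-(((k : ℝ) - 2) * ε)) ≤ segL γ t v)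
    (hW : segW γ γR γL t v ≤ R ^ (-((k : ℝ) * ε))) :
    ∃ (b' : ℝ) (γ' γ'R γ'L : ℝ → ℝ), 0 < b' ∧
      (fun ξ : ℝ × ℝ =>
          (R ^ ((k : ℝ) * ε) / Real.sqrt (1 + γR t ^ 2) *
             ((ξ.1 - t) + γR t * (ξ.2 - γ t)),
           R ^ ((k : ℝ) * ε) / Real.sqrt (1 + γR t ^ 2) *
             (-(γR t) * (ξ.1 - t) + (ξ.2 - γ t)))) ''
        {p : ℝ × ℝ | ∃ x ∈ Icc t v, p = (x, γ x)} =
        {p : ℝ × ℝ | ∃ x ∈ Icc 0 b', p = (x, γ' x)} ∧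
      AdmissiblePair R ε γ' γ'R γ'L 0 b' := by
  obtain ⟨-, hconv, hder, -, -, -, hRa, -⟩ := hadm
  have hR0 : 0 < R := one_pos.trans_le hR
  have hab : a < b := hat.trans_lt (htv.trans_le hvb)
  have hmono : MonotoneOn γ (Icc a b) :=
    hconv.monotoneOn_of_rightDeriv_nonneg (hder.1 a ⟨le_rfl, hab⟩) hRa.ge
  have hsub : Icc t v ⊆ Icc a b := Icc_subset_Icc hat hvb
  have hder' := hder.mono hat hvb
  have hm : 0 ≤ γR t := hder'.rightDeriv_nonneg (hmono.mono hsub) ⟨le_rfl, htv⟩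
  set m := γR t with hmdef
  set c := R ^ ((k : ℝ) * ε) with hc
  have hc0 : 0 < c := Real.rpow_pos_of_pos hR0 _
  have hs0 : 0 < Real.sqrt (1 + m ^ 2) := Real.sqrt_pos.2 (by positivity)
  have hp0 : 0 < c / Real.sqrt (1 + m ^ 2) := div_pos hc0 hs0
  obtain ⟨b', γ', γ'R, γ'L, hb', himg, hconv', hder'', hbeq, h0, hγb, hR', hL'⟩ :=
    exists_convexOn_graph_of_rotation htv hm hp0 (hconv.subset hsub (convex_Icc _ _))
      (hmono.mono hsub) hder'
  have hR0' : γ'R 0 = 0 := by rw [hR', ← hmdef]; simp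
  have hA : segA γ'R γ'L 0 b' = segA γR γL t v := by
    simp only [segA, hR0', hL', ← hmdef]
    ring
  have hL : segL γ' 0 b' = c * segL γ t v := by
    have hp2 : (c / Real.sqrt (1 + m ^ 2)) ^ 2 * (1 + m ^ 2) = c ^ 2 := by
      rw [div_pow, Real.sq_sqrt (by positivity), div_mul_cancel₀ _ (by positivity)]
    have hsq : (b' - 0) ^ 2 + (γ' b' - γ' 0) ^ 2 = c ^ 2 * ((v - t) ^ 2 + (γ v - γ t) ^ 2) := by
      rw [h0, hγb, hbeq, ← hp2]
      ring
    rw [segL, segL, hsq, Real.sqrt_mul (sq_nonneg c), Real.sqrt_sq hc0.le]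
  have hcinv : R ^ (-((k : ℝ) * ε)) = c⁻¹ := Real.rpow_neg hR0.le _
  have hLpos : 0 < segL γ t v := (Real.rpow_pos_of_pos hR0 _).trans_le hlen
  have hL2 : R ^ (2 * ε) ≤ c * segL γ t v := by
    refine le_trans (le_of_eq ?_) (mul_le_mul_of_nonneg_left hlen hc0.le)
    rw [hc, ← Real.rpow_add hR0]
    congr 1
    ring
  have hW1 : c * segL γ t v * segA γR γL t v ≤ 1 := by
    rw [hcinv] at hW
    have := mul_le_mul_of_nonneg_left hW hc0.le
    rwa [mul_inv_cancel₀ hc0.ne', segW, ← mul_assoc] at this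
  refine ⟨b', γ', γ'R, γ'L, hb', himg, hb', hconv', hder'', ?_, hL ▸ hL2, h0, hR0', ?_⟩
  · rw [hA, Real.rpow_neg hR0.le]
    have h1 : segA γR γL t v ≤ (c * segL γ t v)⁻¹ := by
      rwa [← one_div, le_div_iff₀ (mul_pos hc0 hLpos), mul_comm]
    exact h1.trans (inv_anti₀ (Real.rpow_pos_of_pos hR0 _) hL2)
  · rw [segW, hL, hA]
    exact hW1
end
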